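/- Under the sequential experiment with covariates, E[(τ̂₂ˣ − τ)²] = (1/n)·E_X[(τ(X) − τ)²] + (1/n²)·E[ Σ_{i=1}^n (σ⁽¹⁾(X_i))²/e_i(X_i) + (σ⁽⁰⁾(X_i))²/(1 − e_i(X_i)) ]; in particular, when e_i(x) = e*(x) = σ⁽¹⁾(x)/(σ⁽¹⁾(x) + σ⁽⁰⁾(x)) for all i, E[(τ̂*ˣ − τ)²] = (1/n)·( E_X[(σ⁽¹⁾(X) + σ⁽⁰⁾(X))²] + E_X[(τ(X) − τ)²] ), the generalized Neyman allocation bound V*. -/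

import Mathlib

open MeasureTheory ProbabilityTheory

namespace CovariateExperiment

/-- The intermediary AIPW estimator `τ̂₂ˣ` using the true mean functions. -/
noncomputable def tauHat2X {Ω 𝒳 : Type*} (n : ℕ) (μ1 μ0 : 𝒳 → ℝ)
    (X : Fin n → Ω → 𝒳) (W Y : Fin n → Ω → ℝ) (e : Fin n → Ω → 𝒳 → ℝ) (ω : Ω) : ℝ :=
  (1 / (n : ℝ)) * ∑ i : Fin n, (μ1 (X i ω) - μ0 (X i ω)
    + (Y i ω - μ1 (X i ω)) * W i ω / e i ω (X i ω)
    - (Y i ω - μ0 (X i ω)) * (1 - W i ω) / (1 - e i ω (X i ω)))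

/-- A sequential (possibly adaptive) experiment with covariates: i.i.d. covariates with
law `PX`, mean functions `μ1, μ0`, standard-deviation functions `σ1, σ0 > 0`,
filtration `F`, covariates `X`, treatments `W`, outcomes `Y` and (random,
`𝓕_{i−1}`-measurable) propensity functions `e i : Ω → 𝒳 → (0,1)`. -/
structure IsSeqExpX {Ω 𝒳 : Type*} [m0 : MeasurableSpace Ω] [m𝒳 : MeasurableSpace 𝒳]
    (P : Measure Ω) (PX : Measure 𝒳) (n : ℕ)
    (μ1 μ0 σ1 σ0 : 𝒳 → ℝ) (F : ℕ → MeasurableSpace Ω)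
    (X : Fin n → Ω → 𝒳) (W Y : Fin n → Ω → ℝ)
    (e : Fin n → Ω → 𝒳 → ℝ) : Prop where
  isProb : IsProbabilityMeasure P
  isProbX : IsProbabilityMeasure PX
  mu1_meas : Measurable μ1
  mu0_meas : Measurable μ0
  sigma1_meas : Measurable σ1
  sigma0_meas : Measurable σ0
  /-- the mean functions are bounded -/
  mu_bdd : ∃ M : ℝ, ∀ x, |μ1 x| ≤ M ∧ |μ0 x| ≤ M
  /-- the standard-deviation functions are positive -/
  sigma_pos : ∀ x, 0 < σ1 x ∧ 0 < σ0 x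
  F_mono : Monotone F
  F_le : ∀ k, F k ≤ m0
  /-- the data of unit `i` is `𝓕ᵢ`-measurable -/
  X_meas : ∀ i : Fin n, Measurable[F (i.val + 1)] (X i)
  W_meas : ∀ i : Fin n, Measurable[F (i.val + 1)] (W i)
  Y_meas : ∀ i : Fin n, Measurable[F (i.val + 1)] (Y i)
  /-- the covariates are i.i.d. with law `PX`: each `Xᵢ` has law `PX` and is
  independent of the past -/
  X_law : ∀ i : Fin n, Measure.map (X i) P = PX
  X_indep : ∀ i : Fin n, Indep (MeasurableSpace.comap (X i) m𝒳) (F i.val) P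
  /-- the propensity function of round `i` is `𝓕_{i−1}`-measurable -/
  e_meas : ∀ i : Fin n,
    Measurable[(F i.val).prod m𝒳] (fun p : Ω × 𝒳 => e i p.1 p.2)
  e_mem : ∀ i ω x, e i ω x ∈ Set.Ioo (0 : ℝ) 1
  W_bool : ∀ i ω, W i ω = 0 ∨ W i ω = 1
  /-- `P(Wᵢ = 1 | 𝓕_{i−1}, Xᵢ) = eᵢ(Xᵢ)` -/
  W_condexp : ∀ i : Fin n,
    P[W i|F i.val ⊔ MeasurableSpace.comap (X i) m𝒳] =ᵐ[P]
      fun ω => e i ω (X i ω)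
  /-- conditionally on `𝓕_{i−1}, Xᵢ, Wᵢ`, the outcome has mean `μ^{(Wᵢ)}(Xᵢ)` -/
  Y_mean : ∀ i : Fin n,
    P[Y i|F i.val ⊔ MeasurableSpace.comap (X i) m𝒳 ⊔
        MeasurableSpace.comap (W i) (inferInstance : MeasurableSpace ℝ)] =ᵐ[P]
      fun ω => μ1 (X i ω) * W i ω + μ0 (X i ω) * (1 - W i ω)
  /-- conditionally on `𝓕_{i−1}, Xᵢ, Wᵢ`, the outcome has variance `(σ^{(Wᵢ)}(Xᵢ))²` -/
  Y_var : ∀ i : Fin n,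
    P[(fun ω => (Y i ω - (μ1 (X i ω) * W i ω + μ0 (X i ω) * (1 - W i ω))) ^ 2)|
        F i.val ⊔ MeasurableSpace.comap (X i) m𝒳 ⊔
          MeasurableSpace.comap (W i) (inferInstance : MeasurableSpace ℝ)] =ᵐ[P]
      fun ω => (σ1 (X i ω)) ^ 2 * W i ω + (σ0 (X i ω)) ^ 2 * (1 - W i ω)
  /-- integrability of all the squares appearing in the analysis -/
  int_Y_sq : ∀ i : Fin n, Integrable (fun ω => (Y i ω) ^ 2) P
  int_term_sq : ∀ i : Fin n, Integrable
    (fun ω => ((Y i ω - μ1 (X i ω)) * W i ω / e i ω (X i ω)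
      - (Y i ω - μ0 (X i ω)) * (1 - W i ω) / (1 - e i ω (X i ω))) ^ 2) P
  int_var_e : ∀ i : Fin n, Integrable
    (fun ω => (σ1 (X i ω)) ^ 2 / e i ω (X i ω)
      + (σ0 (X i ω)) ^ 2 / (1 - e i ω (X i ω))) P
  int_sigma_sq : Integrable (fun x => (σ1 x + σ0 x) ^ 2) PX

section Helpers

/-- Replacing a factor by its conditional expectation inside an integral. -/
theorem integral_mul_eq_of_condExp_eq {Ω : Type*} {m mΩ : MeasurableSpace Ω} {P : Measure Ω}
    [IsFiniteMeasure P] (hm : m ≤ mΩ) {f g h : Ω → ℝ} (hf : StronglyMeasurable[m] f)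
    (hfg : Integrable (f * g) P) (hg : Integrable g P) (hgh : P[g|m] =ᵐ[P] h) :
    Integrable (f * h) P ∧ ∫ ω, f ω * g ω ∂P = ∫ ω, f ω * h ω ∂P := by
  have key : P[f * g|m] =ᵐ[P] f * h :=
    (condExp_mul_of_stronglyMeasurable_left hf hfg hg).trans
      (hgh.mono fun ω hω => by simp [hω])
  refine ⟨integrable_condExp.congr key, ?_⟩
  calc ∫ ω, f ω * g ω ∂P = ∫ ω, (P[f * g|m]) ω ∂P := (integral_condExp hm).symm
    _ = ∫ ω, f ω * h ω ∂P := integral_congr_ae key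

/-- The inverse-propensity weight of a unit, signed by its treatment arm. -/
noncomputable def ipwWeight {Ω 𝒳 : Type*} (X : Ω → 𝒳) (W : Ω → ℝ) (e : Ω → 𝒳 → ℝ) (ω : Ω) : ℝ :=
  W ω / e ω (X ω) - (1 - W ω) / (1 - e ω (X ω))

/-- The deviation of an outcome from its conditional mean. -/
def outcomeResidual {Ω 𝒳 : Type*} (μ1 μ0 : 𝒳 → ℝ) (X : Ω → 𝒳) (W Y : Ω → ℝ) (ω : Ω) : ℝ :=
  Y ω - (μ1 (X ω) * W ω + μ0 (X ω) * (1 - W ω))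

/-- The centered conditional treatment effect at the covariate of a unit. -/
noncomputable def centeredEffect {Ω 𝒳 : Type*} [MeasurableSpace 𝒳] (PX : Measure 𝒳)
    (μ1 μ0 : 𝒳 → ℝ) (X : Ω → 𝒳) (ω : Ω) : ℝ :=
  μ1 (X ω) - μ0 (X ω) - ∫ x, (μ1 x - μ0 x) ∂PX

namespace IsSeqExpX

variable {Ω 𝒳 : Type*} {m0 : MeasurableSpace Ω} [m𝒳 : MeasurableSpace 𝒳]
  {P : Measure Ω} {PX : Measure 𝒳} {n : ℕ} {μ1 μ0 σ1 σ0 : 𝒳 → ℝ} {F : ℕ → MeasurableSpace Ω}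
  {X : Fin n → Ω → 𝒳} {W Y : Fin n → Ω → ℝ} {e : Fin n → Ω → 𝒳 → ℝ}

theorem sup_comap_X_le (h : IsSeqExpX P PX n μ1 μ0 σ1 σ0 F X W Y e) (i : Fin n) :
    F i.val ⊔ MeasurableSpace.comap (X i) m𝒳 ≤ F (i.val + 1) :=
  sup_le (h.F_mono (Nat.le_succ _)) (h.X_meas i).comap_le

theorem sup_comap_XW_le (h : IsSeqExpX P PX n μ1 μ0 σ1 σ0 F X W Y e) (i : Fin n) :
    F i.val ⊔ MeasurableSpace.comap (X i) m𝒳 ⊔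
      MeasurableSpace.comap (W i) (inferInstance : MeasurableSpace ℝ) ≤ F (i.val + 1) :=
  sup_le (h.sup_comap_X_le i) (h.W_meas i).comap_le

theorem measurable_X_of_le {i : Fin n} {m : MeasurableSpace Ω}
    (hm : F i.val ⊔ MeasurableSpace.comap (X i) m𝒳 ≤ m) : Measurable[m] (X i) :=
  (comap_measurable (X i)).mono (le_sup_right.trans hm) le_rfl

theorem measurable_propensity (h : IsSeqExpX P PX n μ1 μ0 σ1 σ0 F X W Y e) {i : Fin n}
    {m : MeasurableSpace Ω} (hm : F i.val ⊔ MeasurableSpace.comap (X i) m𝒳 ≤ m) :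
    Measurable[m] fun ω => e i ω (X i ω) := by
  have hid : @Measurable Ω Ω m (F i.val) id :=
    measurable_id.mono (le_sup_left.trans hm) le_rfl
  have hpair : @Measurable Ω (Ω × 𝒳) m ((F i.val).prod m𝒳) fun ω => (ω, X i ω) :=
    @Measurable.prodMk _ m _ _ (F i.val) m𝒳 _ _ hid (measurable_X_of_le hm)
  exact (h.e_meas (m0 := m0) i).comp hpair

theorem measurable_ipwWeight (h : IsSeqExpX P PX n μ1 μ0 σ1 σ0 F X W Y e) {i : Fin n}
    {m : MeasurableSpace Ω} (hm : F i.val ⊔ MeasurableSpace.comap (X i) m𝒳 ≤ m)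
    (hW : Measurable[m] (W i)) : Measurable[m] (ipwWeight (X i) (W i) (e i)) := by
  have he := h.measurable_propensity hm
  exact (hW.div he).sub ((measurable_const.sub hW).div (measurable_const.sub he))

theorem measurable_outcomeResidual (h : IsSeqExpX P PX n μ1 μ0 σ1 σ0 F X W Y e) (i : Fin n) :
    Measurable[F (i.val + 1)] (outcomeResidual μ1 μ0 (X i) (W i) (Y i)) :=
  (h.Y_meas i).sub (((h.mu1_meas.comp (h.X_meas i)).mul (h.W_meas i)).add
    ((h.mu0_meas.comp (h.X_meas i)).mul (measurable_const.sub (h.W_meas i))))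

theorem measurable_centeredEffect (h : IsSeqExpX P PX n μ1 μ0 σ1 σ0 F X W Y e) {i : Fin n}
    {m : MeasurableSpace Ω} (hX : Measurable[m] (X i)) :
    Measurable[m] (centeredEffect PX μ1 μ0 (X i)) :=
  (((h.mu1_meas (m0 := m0)).comp hX).sub ((h.mu0_meas (m0 := m0)).comp hX)).sub measurable_const

theorem memLp_W (h : IsSeqExpX P PX n μ1 μ0 σ1 σ0 F X W Y e) (i : Fin n) : MemLp (W i) ⊤ P := by
  have := h.isProb
  refine memLp_top_of_bound ((h.W_meas i).mono (h.F_le _) le_rfl).aestronglyMeasurable 1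
    (ae_of_all _ fun ω => ?_)
  rcases h.W_bool i ω with hw | hw <;> simp [hw]

theorem memLp_conditionalMean (h : IsSeqExpX P PX n μ1 μ0 σ1 σ0 F X W Y e) (i : Fin n) :
    MemLp (fun ω => μ1 (X i ω) * W i ω + μ0 (X i ω) * (1 - W i ω)) 2 P := by
  have := h.isProb
  obtain ⟨M, hM⟩ := h.mu_bdd
  have hX := (h.X_meas i).mono (h.F_le _) le_rfl
  have hW := (h.W_meas i).mono (h.F_le _) le_rfl
  refine MemLp.of_bound (((h.mu1_meas.comp hX).mul hW).add
    ((h.mu0_meas.comp hX).mul (measurable_const.sub hW))).aestronglyMeasurable M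
    (ae_of_all _ fun ω => ?_)
  rcases h.W_bool i ω with hw | hw
  · simpa [hw] using (hM (X i ω)).2
  · simpa [hw] using (hM (X i ω)).1

theorem memLp_Y (h : IsSeqExpX P PX n μ1 μ0 σ1 σ0 F X W Y e) (i : Fin n) : MemLp (Y i) 2 P :=
  (memLp_two_iff_integrable_sq
    ((h.Y_meas i).mono (h.F_le _) le_rfl).aestronglyMeasurable).2 (h.int_Y_sq i)

theorem memLp_outcomeResidual (h : IsSeqExpX P PX n μ1 μ0 σ1 σ0 F X W Y e) (i : Fin n) :
    MemLp (outcomeResidual μ1 μ0 (X i) (W i) (Y i)) 2 P :=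
  (h.memLp_Y i).sub (h.memLp_conditionalMean i)

theorem memLp_centeredEffect (h : IsSeqExpX P PX n μ1 μ0 σ1 σ0 F X W Y e) (i : Fin n) :
    MemLp (centeredEffect PX μ1 μ0 (X i)) 2 P := by
  have := h.isProb
  obtain ⟨M, hM⟩ := h.mu_bdd
  refine MemLp.of_bound (h.measurable_centeredEffect
    ((h.X_meas i).mono (h.F_le _) le_rfl)).aestronglyMeasurable
    (M + M + |∫ x, (μ1 x - μ0 x) ∂PX|) (ae_of_all _ fun ω => ?_)
  have h1 := (hM (X i ω)).1
  have h2 := (hM (X i ω)).2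
  rw [Real.norm_eq_abs]
  calc |centeredEffect PX μ1 μ0 (X i) ω|
      ≤ |μ1 (X i ω) - μ0 (X i ω)| + |∫ x, (μ1 x - μ0 x) ∂PX| := abs_sub _ _
    _ ≤ |μ1 (X i ω)| + |μ0 (X i ω)| + |∫ x, (μ1 x - μ0 x) ∂PX| := by
      gcongr; exact abs_sub _ _
    _ ≤ _ := by gcongr

theorem ipwWeight_mul_outcomeResidual (h : IsSeqExpX P PX n μ1 μ0 σ1 σ0 F X W Y e) (i : Fin n)
    (ω : Ω) :
    ipwWeight (X i) (W i) (e i) ω * outcomeResidual μ1 μ0 (X i) (W i) (Y i) ω =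
      (Y i ω - μ1 (X i ω)) * W i ω / e i ω (X i ω)
      - (Y i ω - μ0 (X i ω)) * (1 - W i ω) / (1 - e i ω (X i ω)) := by
  rcases h.W_bool i ω with hw | hw <;> simp [ipwWeight, outcomeResidual, hw] <;> ring

theorem memLp_ipwTerm (h : IsSeqExpX P PX n μ1 μ0 σ1 σ0 F X W Y e) (i : Fin n) :
    MemLp (ipwWeight (X i) (W i) (e i) * outcomeResidual μ1 μ0 (X i) (W i) (Y i)) 2 P := by
  have hmeas : Measurable[F (i.val + 1)]
      (ipwWeight (X i) (W i) (e i) * outcomeResidual μ1 μ0 (X i) (W i) (Y i)) :=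
    (h.measurable_ipwWeight (h.sup_comap_X_le i) (h.W_meas i)).mul (h.measurable_outcomeResidual i)
  refine (memLp_two_iff_integrable_sq
    (hmeas.mono (h.F_le _) le_rfl).aestronglyMeasurable).2 ?_
  refine (h.int_term_sq i).congr (ae_of_all _ fun ω => ?_)
  simp only [Pi.mul_apply, h.ipwWeight_mul_outcomeResidual]

theorem condExp_outcomeResidual (h : IsSeqExpX P PX n μ1 μ0 σ1 σ0 F X W Y e) (i : Fin n) :
    P[outcomeResidual μ1 μ0 (X i) (W i) (Y i)|F i.val ⊔ MeasurableSpace.comap (X i) m𝒳 ⊔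
      MeasurableSpace.comap (W i) (inferInstance : MeasurableSpace ℝ)] =ᵐ[P] 0 := by
  have := h.isProb
  have hle := (h.sup_comap_XW_le i).trans (h.F_le _)
  have hX : Measurable[F i.val ⊔ MeasurableSpace.comap (X i) m𝒳 ⊔
      MeasurableSpace.comap (W i) (inferInstance : MeasurableSpace ℝ)] (X i) :=
    measurable_X_of_le le_sup_left
  have hW : Measurable[F i.val ⊔ MeasurableSpace.comap (X i) m𝒳 ⊔
      MeasurableSpace.comap (W i) (inferInstance : MeasurableSpace ℝ)] (W i) :=
    (comap_measurable (W i)).mono le_sup_right le_rfl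
  have hmean : Measurable[F i.val ⊔ MeasurableSpace.comap (X i) m𝒳 ⊔
      MeasurableSpace.comap (W i) (inferInstance : MeasurableSpace ℝ)]
      fun ω => μ1 (X i ω) * W i ω + μ0 (X i ω) * (1 - W i ω) := ((h.mu1_meas.comp hX).mul hW).add
    ((h.mu0_meas.comp hX).mul (hW.const_sub 1))
  have hint := (h.memLp_conditionalMean i).integrable one_le_two
  have hsub := condExp_sub ((h.memLp_Y i).integrable one_le_two) hint
    (F i.val ⊔ MeasurableSpace.comap (X i) m𝒳 ⊔
      MeasurableSpace.comap (W i) (inferInstance : MeasurableSpace ℝ))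
  rw [condExp_of_stronglyMeasurable hle hmean.stronglyMeasurable hint] at hsub
  refine Filter.EventuallyEq.trans hsub ?_
  filter_upwards [h.Y_mean i] with ω hω
  simp only [Pi.sub_apply, Pi.zero_apply]
  rw [hω, sub_self]

/-- The weighted residual is orthogonal to everything known before the outcome is drawn. -/
theorem integral_mul_ipwTerm (h : IsSeqExpX P PX n μ1 μ0 σ1 σ0 F X W Y e) (i : Fin n)
    {Z : Ω → ℝ} (hZ : Measurable[F i.val ⊔ MeasurableSpace.comap (X i) m𝒳 ⊔
      MeasurableSpace.comap (W i) (inferInstance : MeasurableSpace ℝ)] Z) (hZ2 : MemLp Z 2 P) :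
    ∫ ω, Z ω * (ipwWeight (X i) (W i) (e i) ω *
      outcomeResidual μ1 μ0 (X i) (W i) (Y i) ω) ∂P = 0 := by
  have := h.isProb
  have hA := h.measurable_ipwWeight (i := i) (le_sup_left (b := MeasurableSpace.comap (W i)
    (inferInstance : MeasurableSpace ℝ))) ((comap_measurable (W i)).mono le_sup_right le_rfl)
  have hint := hZ2.integrable_mul (h.memLp_ipwTerm i)
  rw [← mul_assoc] at hint
  have key := (integral_mul_eq_of_condExp_eq ((h.sup_comap_XW_le i).trans (h.F_le _))
    (hZ.mul hA).stronglyMeasurable hint ((h.memLp_outcomeResidual i).integrable one_le_two)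
    (h.condExp_outcomeResidual i)).2
  simpa [mul_assoc] using key

/-- The second moment of the weighted residual. -/
theorem integral_ipwTerm_sq (h : IsSeqExpX P PX n μ1 μ0 σ1 σ0 F X W Y e) (i : Fin n) :
    ∫ ω, (ipwWeight (X i) (W i) (e i) ω * outcomeResidual μ1 μ0 (X i) (W i) (Y i) ω) ^ 2 ∂P =
      ∫ ω, ((σ1 (X i ω)) ^ 2 / e i ω (X i ω)
        + (σ0 (X i ω)) ^ 2 / (1 - e i ω (X i ω))) ∂P := by
  have := h.isProb
  have hHle := (h.sup_comap_XW_le i).trans (h.F_le _)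
  have hGle := (h.sup_comap_X_le i).trans (h.F_le _)
  have hA := h.measurable_ipwWeight (i := i) (le_sup_left (b := MeasurableSpace.comap (W i)
    (inferInstance : MeasurableSpace ℝ))) ((comap_measurable (W i)).mono le_sup_right le_rfl)
  have hXG : Measurable[F i.val ⊔ MeasurableSpace.comap (X i) m𝒳] (X i) :=
    measurable_X_of_le le_rfl
  have heG := h.measurable_propensity (i := i) le_rfl
  have ha : Measurable[F i.val ⊔ MeasurableSpace.comap (X i) m𝒳]
      fun ω => (σ1 (X i ω)) ^ 2 / (e i ω (X i ω)) ^ 2 :=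
    ((h.sigma1_meas.comp hXG).pow_const 2).div (heG.pow_const 2)
  have hb : Measurable[F i.val ⊔ MeasurableSpace.comap (X i) m𝒳]
      fun ω => (σ0 (X i ω)) ^ 2 / (1 - e i ω (X i ω)) ^ 2 :=
    ((h.sigma0_meas.comp hXG).pow_const 2).div ((measurable_const.sub heG).pow_const 2)
  have hWm := (h.W_meas i).mono (h.F_le _) le_rfl
  have hWint : Integrable (W i) P := (h.memLp_W i).integrable le_top
  have hW1int : Integrable (fun ω => 1 - W i ω) P := (integrable_const 1).sub hWint
  have hsq : Integrable ((fun ω => (ipwWeight (X i) (W i) (e i) ω) ^ 2) *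
      fun ω => (outcomeResidual μ1 μ0 (X i) (W i) (Y i) ω) ^ 2) P :=
    (h.memLp_ipwTerm i).integrable_sq.congr (ae_of_all _ fun ω => by simp [mul_pow])
  obtain ⟨hint, heq⟩ := integral_mul_eq_of_condExp_eq hHle (hA.pow_const 2).stronglyMeasurable
    hsq (h.memLp_outcomeResidual i).integrable_sq (h.Y_var i)
  have hsplit : ∀ ω, (ipwWeight (X i) (W i) (e i) ω) ^ 2 *
      ((σ1 (X i ω)) ^ 2 * W i ω + (σ0 (X i ω)) ^ 2 * (1 - W i ω)) =
      (σ1 (X i ω)) ^ 2 / (e i ω (X i ω)) ^ 2 * W i ω +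
        (σ0 (X i ω)) ^ 2 / (1 - e i ω (X i ω)) ^ 2 * (1 - W i ω) := by
    intro ω
    rcases h.W_bool i ω with hw | hw <;> simp [ipwWeight, hw, div_eq_mul_inv] <;> ring
  have hint1 : Integrable ((fun ω => (σ1 (X i ω)) ^ 2 / (e i ω (X i ω)) ^ 2) * W i) P := by
    refine hint.mono ((ha.mono hGle le_rfl).mul hWm).aestronglyMeasurable
      (ae_of_all _ fun ω => ?_)
    simp only [Pi.mul_apply, hsplit]
    rcases h.W_bool i ω with hw | hw <;> simp [hw]
    positivity
  have hint0 : Integrable ((fun ω => (σ0 (X i ω)) ^ 2 / (1 - e i ω (X i ω)) ^ 2) *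
      fun ω => 1 - W i ω) P := by
    refine hint.mono ((hb.mono hGle le_rfl).mul
      (measurable_const.sub hWm)).aestronglyMeasurable (ae_of_all _ fun ω => ?_)
    simp only [Pi.mul_apply, hsplit]
    rcases h.W_bool i ω with hw | hw <;> simp [hw]
    positivity
  have hcond1 : P[fun ω => 1 - W i ω|F i.val ⊔ MeasurableSpace.comap (X i) m𝒳] =ᵐ[P]
      fun ω => 1 - e i ω (X i ω) := by
    refine Filter.EventuallyEq.trans (condExp_sub (integrable_const (1 : ℝ)) hWint _) ?_
    filter_upwards [h.W_condexp i] with ω hω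
    simp only [Pi.sub_apply, hω, condExp_const hGle]
  obtain ⟨hI1, hE1⟩ := integral_mul_eq_of_condExp_eq hGle ha.stronglyMeasurable hint1 hWint
    (h.W_condexp i)
  obtain ⟨hI0, hE0⟩ := integral_mul_eq_of_condExp_eq hGle hb.stronglyMeasurable hint0 hW1int
    hcond1
  simp_rw [mul_pow]
  rw [heq]
  simp_rw [hsplit]
  refine (integral_add hint1 hint0).trans ?_
  simp only [Pi.mul_apply]
  rw [hE1, hE0]
  refine (integral_add hI1 hI0).symm.trans ?_
  refine integral_congr_ae (ae_of_all _ fun ω => ?_)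
  have h1 : e i ω (X i ω) ≠ 0 := (h.e_mem i ω _).1.ne'
  have h0 : 1 - e i ω (X i ω) ≠ 0 := (sub_pos.2 (h.e_mem i ω _).2).ne'
  simp only [Pi.mul_apply]
  field_simp

theorem integral_comp_X (h : IsSeqExpX P PX n μ1 μ0 σ1 σ0 F X W Y e) (i : Fin n) {f : 𝒳 → ℝ}
    (hf : Measurable f) : ∫ ω, f (X i ω) ∂P = ∫ x, f x ∂PX := by
  rw [← h.X_law i, integral_map ((h.X_meas i).mono (h.F_le _) le_rfl).aemeasurable
    hf.aestronglyMeasurable]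

theorem integral_centeredEffect (h : IsSeqExpX P PX n μ1 μ0 σ1 σ0 F X W Y e) (i : Fin n) :
    ∫ ω, centeredEffect PX μ1 μ0 (X i) ω ∂P = 0 := by
  have := h.isProb
  have := h.isProbX
  obtain ⟨M, hM⟩ := h.mu_bdd
  have h1 : Integrable μ1 PX := .of_bound h.mu1_meas.aestronglyMeasurable M
    (ae_of_all _ fun x => (hM x).1)
  have h0 : Integrable μ0 PX := .of_bound h.mu0_meas.aestronglyMeasurable M
    (ae_of_all _ fun x => (hM x).2)
  unfold centeredEffect
  rw [h.integral_comp_X i (f := fun x => μ1 x - μ0 x - ∫ x', (μ1 x' - μ0 x') ∂PX)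
    ((h.mu1_meas.sub h.mu0_meas).sub measurable_const)]
  refine (integral_sub (h1.sub h0) (integrable_const _)).trans ?_
  simp

theorem integral_mul_centeredEffect (h : IsSeqExpX P PX n μ1 μ0 σ1 σ0 F X W Y e) (i : Fin n)
    {Z : Ω → ℝ} (hZ : Measurable[F i.val] Z) :
    ∫ ω, Z ω * centeredEffect PX μ1 μ0 (X i) ω ∂P = 0 := by
  have hb : Measurable[MeasurableSpace.comap (X i) m𝒳] (centeredEffect PX μ1 μ0 (X i)) :=
    h.measurable_centeredEffect (comap_measurable (X i))
  have hXle : MeasurableSpace.comap (X i) m𝒳 ≤ m0 := (h.X_meas i).comap_le.trans (h.F_le _)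
  have hind : IndepFun Z (centeredEffect PX μ1 μ0 (X i)) P := by
    rw [IndepFun_iff_Indep]
    exact indep_of_indep_of_le_left
      (indep_of_indep_of_le_right (h.X_indep i).symm hb.comap_le) hZ.comap_le
  rw [hind.integral_fun_mul_eq_mul_integral
    (hZ.mono (h.F_le _) le_rfl).aestronglyMeasurable
    (hb.mono hXle le_rfl).aestronglyMeasurable, h.integral_centeredEffect, mul_zero]

/-- The contribution of a unit to the estimation error is square integrable. -/
theorem memLp_unitError (h : IsSeqExpX P PX n μ1 μ0 σ1 σ0 F X W Y e) (i : Fin n) :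
    MemLp (centeredEffect PX μ1 μ0 (X i) +
      ipwWeight (X i) (W i) (e i) * outcomeResidual μ1 μ0 (X i) (W i) (Y i)) 2 P :=
  (h.memLp_centeredEffect i).add (h.memLp_ipwTerm i)

theorem integral_unitError_mul_of_lt (h : IsSeqExpX P PX n μ1 μ0 σ1 σ0 F X W Y e) {i j : Fin n}
    (hij : i < j) :
    ∫ ω, (centeredEffect PX μ1 μ0 (X i) +
        ipwWeight (X i) (W i) (e i) * outcomeResidual μ1 μ0 (X i) (W i) (Y i)) ω *
      (centeredEffect PX μ1 μ0 (X j) +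
        ipwWeight (X j) (W j) (e j) * outcomeResidual μ1 μ0 (X j) (W j) (Y j)) ω ∂P = 0 := by
  have hi := h.memLp_unitError i
  have hmeas : Measurable[F (i.val + 1)] (centeredEffect PX μ1 μ0 (X i) +
      ipwWeight (X i) (W i) (e i) * outcomeResidual μ1 μ0 (X i) (W i) (Y i)) :=
    (h.measurable_centeredEffect (h.X_meas i)).add
      ((h.measurable_ipwWeight (h.sup_comap_X_le i) (h.W_meas i)).mul
        (h.measurable_outcomeResidual i))
  have hmeasj := hmeas.mono (h.F_mono (show i.val + 1 ≤ j.val from hij)) le_rfl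
  generalize centeredEffect PX μ1 μ0 (X i) +
      ipwWeight (X i) (W i) (e i) * outcomeResidual μ1 μ0 (X i) (W i) (Y i) = D at *
  simp_rw [Pi.add_apply, mul_add]
  refine (integral_add (hi.integrable_mul (h.memLp_centeredEffect j))
    (hi.integrable_mul (h.memLp_ipwTerm j))).trans ?_
  simp only [Pi.mul_apply]
  rw [h.integral_mul_centeredEffect j hmeasj,
    h.integral_mul_ipwTerm j (hmeasj.mono (le_sup_left.trans le_sup_left) le_rfl) hi, add_zero]

theorem integral_unitError_sq (h : IsSeqExpX P PX n μ1 μ0 σ1 σ0 F X W Y e) (i : Fin n) :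
    ∫ ω, (centeredEffect PX μ1 μ0 (X i) +
        ipwWeight (X i) (W i) (e i) * outcomeResidual μ1 μ0 (X i) (W i) (Y i)) ω *
      (centeredEffect PX μ1 μ0 (X i) +
        ipwWeight (X i) (W i) (e i) * outcomeResidual μ1 μ0 (X i) (W i) (Y i)) ω ∂P =
      ∫ x, (μ1 x - μ0 x - ∫ x', (μ1 x' - μ0 x') ∂PX) ^ 2 ∂PX +
      ∫ ω, ((σ1 (X i ω)) ^ 2 / e i ω (X i ω)
        + (σ0 (X i ω)) ^ 2 / (1 - e i ω (X i ω))) ∂P := by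
  have hb := h.memLp_centeredEffect i
  have ht := h.memLp_ipwTerm i
  have hcross := h.integral_mul_ipwTerm i
    (h.measurable_centeredEffect (measurable_X_of_le le_sup_left)) hb
  have heffect : ∫ ω, (centeredEffect PX μ1 μ0 (X i) ω) ^ 2 ∂P =
      ∫ x, (μ1 x - μ0 x - ∫ x', (μ1 x' - μ0 x') ∂PX) ^ 2 ∂PX :=
    h.integral_comp_X i (f := fun x => (μ1 x - μ0 x - ∫ x', (μ1 x' - μ0 x') ∂PX) ^ 2)
      (((h.mu1_meas.sub h.mu0_meas).sub measurable_const).pow_const 2)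
  rw [← h.integral_ipwTerm_sq i, ← heffect]
  have hbt := (hb.integrable_mul ht).const_mul 2
  calc _ = ∫ ω, ((centeredEffect PX μ1 μ0 (X i) ω) ^ 2 +
        (ipwWeight (X i) (W i) (e i) ω * outcomeResidual μ1 μ0 (X i) (W i) (Y i) ω) ^ 2 +
        2 * (centeredEffect PX μ1 μ0 (X i) ω * (ipwWeight (X i) (W i) (e i) ω *
          outcomeResidual μ1 μ0 (X i) (W i) (Y i) ω))) ∂P := by
        refine integral_congr_ae (ae_of_all _ fun ω => ?_)
        simp only [Pi.add_apply, Pi.mul_apply]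
        ring
    _ = _ := by
        refine (integral_add (hb.integrable_sq.add ht.integrable_sq) hbt).trans ?_
        rw [integral_const_mul]
        simp only [Pi.mul_apply, Pi.add_apply]
        rw [hcross, mul_zero, add_zero]
        exact integral_add hb.integrable_sq ht.integrable_sq

theorem tauHat2X_sub (h : IsSeqExpX P PX n μ1 μ0 σ1 σ0 F X W Y e) (hn : 1 ≤ n) (ω : Ω) :
    tauHat2X n μ1 μ0 X W Y e ω - ∫ x, (μ1 x - μ0 x) ∂PX =
      (1 / (n : ℝ)) * ∑ i, (centeredEffect PX μ1 μ0 (X i) +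
        ipwWeight (X i) (W i) (e i) * outcomeResidual μ1 μ0 (X i) (W i) (Y i)) ω := by
  have hn0 : (n : ℝ) ≠ 0 := by positivity
  have hterm : ∀ i, (centeredEffect PX μ1 μ0 (X i) +
      ipwWeight (X i) (W i) (e i) * outcomeResidual μ1 μ0 (X i) (W i) (Y i)) ω =
      (μ1 (X i ω) - μ0 (X i ω) + (Y i ω - μ1 (X i ω)) * W i ω / e i ω (X i ω)
        - (Y i ω - μ0 (X i ω)) * (1 - W i ω) / (1 - e i ω (X i ω)))
      - ∫ x, (μ1 x - μ0 x) ∂PX := by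
    intro i
    simp only [Pi.add_apply, Pi.mul_apply, h.ipwWeight_mul_outcomeResidual, centeredEffect]
    ring
  simp_rw [hterm]
  rw [Finset.sum_sub_distrib, mul_sub, tauHat2X]
  simp [hn0]

/-- The mean squared error of the intermediary estimator. -/
theorem integral_tauHat2X_sub_sq (h : IsSeqExpX P PX n μ1 μ0 σ1 σ0 F X W Y e) (hn : 1 ≤ n) :
    ∫ ω, (tauHat2X n μ1 μ0 X W Y e ω - ∫ x, (μ1 x - μ0 x) ∂PX) ^ 2 ∂P =
      (1 / (n : ℝ)) * ∫ x, (μ1 x - μ0 x - ∫ x', (μ1 x' - μ0 x') ∂PX) ^ 2 ∂PX +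
      (1 / (n : ℝ) ^ 2) * ∫ ω, (∑ i : Fin n,
        ((σ1 (X i ω)) ^ 2 / e i ω (X i ω)
          + (σ0 (X i ω)) ^ 2 / (1 - e i ω (X i ω)))) ∂P := by
  have hn0 : (n : ℝ) ≠ 0 := by positivity
  have hint : ∀ i j, Integrable (fun ω => (centeredEffect PX μ1 μ0 (X i) +
        ipwWeight (X i) (W i) (e i) * outcomeResidual μ1 μ0 (X i) (W i) (Y i)) ω *
      (centeredEffect PX μ1 μ0 (X j) +
        ipwWeight (X j) (W j) (e j) * outcomeResidual μ1 μ0 (X j) (W j) (Y j)) ω) P :=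
    fun i j => (h.memLp_unitError i).integrable_mul (h.memLp_unitError j)
  simp_rw [h.tauHat2X_sub hn, mul_pow, sq (∑ i, _), Finset.sum_mul_sum]
  rw [integral_const_mul, integral_finsetSum _ fun i _ =>
      integrable_finsetSum _ fun j _ => hint i j,
    integral_finsetSum _ fun i _ => h.int_var_e i]
  have hrow : ∀ i, ∫ ω, ∑ j, (centeredEffect PX μ1 μ0 (X i) +
        ipwWeight (X i) (W i) (e i) * outcomeResidual μ1 μ0 (X i) (W i) (Y i)) ω *
      (centeredEffect PX μ1 μ0 (X j) +
        ipwWeight (X j) (W j) (e j) * outcomeResidual μ1 μ0 (X j) (W j) (Y j)) ω ∂P =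
      ∫ x, (μ1 x - μ0 x - ∫ x', (μ1 x' - μ0 x') ∂PX) ^ 2 ∂PX +
      ∫ ω, ((σ1 (X i ω)) ^ 2 / e i ω (X i ω)
        + (σ0 (X i ω)) ^ 2 / (1 - e i ω (X i ω))) ∂P := by
    intro i
    rw [integral_finsetSum _ fun j _ => hint i j, Finset.sum_eq_single i,
      h.integral_unitError_sq]
    · intro j _ hji
      rcases hji.lt_or_gt with hlt | hlt
      · simp_rw [mul_comm ((centeredEffect PX μ1 μ0 (X i) + _) _)]
        exact h.integral_unitError_mul_of_lt hlt
      · exact h.integral_unitError_mul_of_lt hlt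
    · simp
  rw [Finset.sum_congr rfl fun i _ => hrow i, Finset.sum_add_distrib]
  simp only [Finset.sum_const, Finset.card_univ, Fintype.card_fin, nsmul_eq_mul]
  field_simp

end IsSeqExpX

end Helpers

/-- In the sequential experiment with covariates,
`E[(τ̂₂ˣ − τ)²] = (1/n)·E_X[(τ(X) − τ)²]
  + (1/n²)·E[Σᵢ (σ⁽¹⁾(Xᵢ))²/eᵢ(Xᵢ) + (σ⁽⁰⁾(Xᵢ))²/(1 − eᵢ(Xᵢ))]`;
in particular, when each `eᵢ` is the generalized Neyman allocation
`e*(x) = σ⁽¹⁾(x)/(σ⁽¹⁾(x)+σ⁽⁰⁾(x))`,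
`E[(τ̂*ˣ − τ)²] = (1/n)(E_X[(σ⁽¹⁾(X)+σ⁽⁰⁾(X))²] + E_X[(τ(X) − τ)²])`,
the generalized Neyman allocation bound `V*`. -/
theorem statement_10 {Ω 𝒳 : Type*} [MeasurableSpace Ω] [MeasurableSpace 𝒳]
    (P : Measure Ω) (PX : Measure 𝒳) (n : ℕ) (hn : 1 ≤ n)
    (μ1 μ0 σ1 σ0 : 𝒳 → ℝ) (F : ℕ → MeasurableSpace Ω)
    (X : Fin n → Ω → 𝒳) (W Y : Fin n → Ω → ℝ) (e : Fin n → Ω → 𝒳 → ℝ)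
    (hExp : IsSeqExpX P PX n μ1 μ0 σ1 σ0 F X W Y e) :
    (∫ ω, (tauHat2X n μ1 μ0 X W Y e ω - ∫ x, (μ1 x - μ0 x) ∂PX) ^ 2 ∂P =
      (1 / (n : ℝ)) * ∫ x, (μ1 x - μ0 x - ∫ x', (μ1 x' - μ0 x') ∂PX) ^ 2 ∂PX +
      (1 / (n : ℝ) ^ 2) * ∫ ω, (∑ i : Fin n,
        ((σ1 (X i ω)) ^ 2 / e i ω (X i ω)
          + (σ0 (X i ω)) ^ 2 / (1 - e i ω (X i ω)))) ∂P) ∧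
    ((∀ i ω x, e i ω x = σ1 x / (σ1 x + σ0 x)) →
      ∫ ω, (tauHat2X n μ1 μ0 X W Y e ω - ∫ x, (μ1 x - μ0 x) ∂PX) ^ 2 ∂P =
        (1 / (n : ℝ)) * (∫ x, (σ1 x + σ0 x) ^ 2 ∂PX +
          ∫ x, (μ1 x - μ0 x - ∫ x', (μ1 x' - μ0 x') ∂PX) ^ 2 ∂PX)) := by
  refine ⟨hExp.integral_tauHat2X_sub_sq hn, fun he => ?_⟩
  have hn0 : (n : ℝ) ≠ 0 := by positivity
  have hvar : ∀ i ω, (σ1 (X i ω)) ^ 2 / e i ω (X i ω) + (σ0 (X i ω)) ^ 2 / (1 - e i ω (X i ω)) =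
      (σ1 (X i ω) + σ0 (X i ω)) ^ 2 := by
    intro i ω
    obtain ⟨h1, h0⟩ := hExp.sigma_pos (X i ω)
    have hs : σ1 (X i ω) + σ0 (X i ω) ≠ 0 := by positivity
    have hc : 1 - σ1 (X i ω) / (σ1 (X i ω) + σ0 (X i ω)) =
        σ0 (X i ω) / (σ1 (X i ω) + σ0 (X i ω)) := by
      field_simp
      ring
    rw [he, hc]
    field_simp
  rw [hExp.integral_tauHat2X_sub_sq hn, integral_finsetSum _ fun i _ => hExp.int_var_e i]
  simp_rw [hvar]
  rw [Finset.sum_congr rfl fun i _ => hExp.integral_comp_X i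
    (f := fun x => (σ1 x + σ0 x) ^ 2) ((hExp.sigma1_meas.add hExp.sigma0_meas).pow_const 2)]
  simp only [Finset.sum_const, Finset.card_univ, Fintype.card_fin, nsmul_eq_mul]
  field_simp
  ring

end CovariateExperiment
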